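/- arXiv:0903.5179 — 2 statements merged into one kernel-verified Lean document; each statement's English description precedes it below -/
import Mathlib

section
/- Let k be a positive integer and let M, N be nonnegative integers with |M − N| ≤ k. Then there exist finitely many nonnegative integers a_0, a_1, …, a_m such that for every real number x, ∑_{l ∈ ℤ} C(M+N, M−kl)^2 · cos(l·x) = ∑_{p=0}^{m} a_p · (1 + cos x)^p. In other words, the trigonometric polynomial ∑_{l} C(M+N, M−kl)^2 cos(lx) is a polynomial in 1 + cos(x) with nonnegative integral coefficients. -/
/-- Binomial coefficient `C(n, b)` with integer lower index, zero unless `0 ≤ b ≤ n`. -/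
def zchoose (n : ℕ) (b : ℤ) : ℕ := if 0 ≤ b then n.choose b.toNat else 0

open Polynomial

theorem zchoose_succ (n : ℕ) (b : ℤ) :
    zchoose (n + 1) b = zchoose n (b - 1) + zchoose n b := by
  unfold zchoose
  rcases lt_trichotomy b 0 with hb | rfl | hb
  · simp [show ¬ 0 ≤ b by omega, show ¬ 1 ≤ b by omega]
  · simp
  · obtain ⟨m, rfl⟩ : ∃ m : ℕ, b = m + 1 := ⟨(b - 1).toNat, by omega⟩
    rw [if_pos (by omega), if_pos (by omega), if_pos (by omega),
      show ((m : ℤ) + 1).toNat = m + 1 by omega, show ((m : ℤ) + 1 - 1).toNat = m by omega,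
      Nat.choose_succ_succ]

theorem zchoose_eq_zero {n : ℕ} {b : ℤ} (h : b < 0 ∨ n < b) : zchoose n b = 0 := by
  unfold zchoose
  split_ifs with hb
  · exact Nat.choose_eq_zero_of_lt (by omega)
  · rfl

theorem zchoose_symm (n : ℕ) (b : ℤ) : zchoose n (n - b) = zchoose n b := by
  by_cases h : 0 ≤ b ∧ b ≤ n
  · obtain ⟨m, rfl⟩ := Int.eq_ofNat_of_zero_le h.1
    have hm : m ≤ n := by omega
    simp only [zchoose, if_pos h.1, if_pos (show (0 : ℤ) ≤ n - m by omega)]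
    rw [show ((n : ℤ) - m).toNat = n - m by omega, Int.toNat_natCast, Nat.choose_symm hm]
  · rw [zchoose_eq_zero (b := b) (by omega), zchoose_eq_zero (by omega)]

section BinomialProductSum

variable {R : Type*} [CommRing R]

/-- The sum `∑ l, C(n, b - k * l) * C(n, c - k * l) * φ l` over all integers `l`. -/
noncomputable def binomialProductSum (k : ℤ) (φ : ℤ → R) (n : ℕ) (b c : ℤ) : R :=
  ∑ᶠ l : ℤ, ((zchoose n (b - k * l) * zchoose n (c - k * l) : ℕ) : R) * φ l

namespace binomialProductSum

variable {k : ℤ} (φ ψ : ℤ → R) (n : ℕ) (b c : ℤ)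

theorem support_finite (hk : 0 < k) :
    (Function.support fun l : ℤ =>
      ((zchoose n (b - k * l) * zchoose n (c - k * l) : ℕ) : R) * φ l).Finite := by
  have hinj : Function.Injective fun l : ℤ => b - k * l := fun x y h => by
    simpa [hk.ne'] using h
  refine ((Set.finite_Icc (0 : ℤ) n).preimage hinj.injOn).subset fun l hl => ?_
  by_contra h
  refine hl ?_
  simp only [Set.mem_preimage, Set.mem_Icc] at h
  simp [zchoose_eq_zero (n := n) (b := b - k * l) (by omega)]

protected theorem add (hk : 0 < k) :
    binomialProductSum k φ n b c + binomialProductSum k ψ n b c =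
      binomialProductSum k (fun l => φ l + ψ l) n b c := by
  unfold binomialProductSum
  rw [← finsum_add_distrib (support_finite φ n b c hk) (support_finite ψ n b c hk)]
  simp only [mul_add]

protected theorem const_mul (hk : 0 < k) (t : R) :
    binomialProductSum k (fun l => t * φ l) n b c = t * binomialProductSum k φ n b c := by
  unfold binomialProductSum
  rw [mul_finsum' _ _ (support_finite φ n b c hk)]
  simp only [mul_left_comm]

protected theorem comm : binomialProductSum k φ n b c = binomialProductSum k φ n c b := by
  unfold binomialProductSum
  simp only [mul_comm (zchoose n (b - _))]

theorem reflect (s : ℤ) :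
    binomialProductSum k φ n b c =
      binomialProductSum k (fun l => φ (s - l)) n (n + k * s - b) (n + k * s - c) := by
  unfold binomialProductSum
  rw [← finsum_comp_equiv (Equiv.subLeft s)]
  refine finsum_congr fun l => ?_
  rw [← zchoose_symm n (b - _), ← zchoose_symm n (c - _)]
  have hsub (d : ℤ) : (n : ℤ) - (d - k * (s - l)) = n + k * s - d - k * l := by ring
  simp only [Equiv.subLeft_apply, hsub]

theorem succ (hk : 0 < k) :
    binomialProductSum k φ (n + 1) b c =
      binomialProductSum k φ n (b - 1) (c - 1) + binomialProductSum k φ n b c +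
        (binomialProductSum k φ n (b - 1) c + binomialProductSum k φ n b (c - 1)) := by
  have hf := fun b c => support_finite φ n b c hk
  unfold binomialProductSum
  rw [← finsum_add_distrib (hf _ _) (hf _ _), ← finsum_add_distrib (hf _ _) (hf _ _),
    ← finsum_add_distrib
      (((hf _ _).union (hf _ _)).subset (Function.support_add _ _))
      (((hf _ _).union (hf _ _)).subset (Function.support_add _ _))]
  refine finsum_congr fun l => ?_
  rw [zchoose_succ, zchoose_succ, sub_right_comm b 1, sub_right_comm c 1]
  push_cast
  ring

theorem zero_mem (A : Subalgebra ℕ R) (hφ : φ 0 = 1) (hb : 0 ≤ b + c) (hb' : b + c ≤ k)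
    (hk : 0 < k) : binomialProductSum k φ 0 b c ∈ A := by
  unfold binomialProductSum
  rw [finsum_eq_single _ 0]
  · rw [hφ, mul_one]
    exact natCast_mem A _
  · intro l hl
    suffices h : b - k * l ≠ 0 ∨ c - k * l ≠ 0 by
      rcases h with h | h
      · simp [zchoose_eq_zero (n := 0) (b := b - k * l) (by push_cast; omega)]
      · simp [zchoose_eq_zero (n := 0) (b := c - k * l) (by push_cast; omega)]
    by_contra! h
    rcases lt_or_gt_of_ne hl with hl | hl <;> nlinarith

/-- The sums against `C` and `D` are polynomials in `t` with natural coefficients whenever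
`C` and `D` satisfy the relations of `cos (l * x)` and `cos ((l - 1 / 2) * x) / cos (x / 2)`, with
`t = 1 + cos x`. -/
theorem mem_adjoin (hk : 0 < k) {t : R} {C D : ℤ → R} (hC₀ : C 0 = 1) (hD₀ : D 0 = 1)
    (hC : ∀ l, C (-l) = C l) (hD : ∀ l, D (1 - l) = D l)
    (hCD : ∀ l, C l + C (1 - l) = t * D l) (hDC : ∀ l, D l + D (-l) = 2 * C l)
    (hb : 0 ≤ b + c - n) (hb' : b + c - n ≤ k) :
    binomialProductSum k C n b c ∈ Algebra.adjoin ℕ {t} ∧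
      binomialProductSum k D n b c ∈ Algebra.adjoin ℕ {t} := by
  induction n generalizing b c with
  | zero =>
    push_cast at hb hb'
    exact ⟨zero_mem C b c _ hC₀ (by omega) (by omega) hk,
      zero_mem D b c _ hD₀ (by omega) (by omega) hk⟩
  | succ n ih =>
    push_cast at hb hb'
    rw [succ C n b c hk, succ D n b c hk]
    have h₁ := ih (b - 1) c (by omega) (by omega)
    have h₂ := ih b (c - 1) (by omega) (by omega)
    refine ⟨add_mem ?_ (add_mem h₁.1 h₂.1), add_mem ?_ (add_mem h₁.2 h₂.2)⟩
    · rcases hb'.eq_or_lt with he | he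
      · have hr : binomialProductSum k C n b c =
            binomialProductSum k (fun l => C (1 - l)) n (b - 1) (c - 1) := by
          rw [reflect C n b c 1, binomialProductSum.comm]
          congr 1 <;> linarith
        rw [hr, binomialProductSum.add _ _ _ _ _ hk]
        simp only [hCD]
        rw [binomialProductSum.const_mul _ _ _ _ hk]
        exact mul_mem (Algebra.self_mem_adjoin_singleton ℕ t)
          (ih (b - 1) (c - 1) (by omega) (by omega)).2
      · refine add_mem ?_ (ih b c (by omega) (by omega)).1
        rcases hb.eq_or_lt with he' | he'
        · rw [reflect C n _ _ 0]
          simp only [zero_sub, hC]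
          exact (ih _ _ (by linarith) (by linarith)).1
        · exact (ih (b - 1) (c - 1) (by omega) (by omega)).1
    · rcases hb.eq_or_lt with he | he
      · have hr : binomialProductSum k D n (b - 1) (c - 1) =
            binomialProductSum k (fun l => D (-l)) n b c := by
          rw [reflect D n _ _ 0, binomialProductSum.comm]
          simp only [zero_sub]
          congr 1 <;> linarith
        rw [hr, add_comm, binomialProductSum.add _ _ _ _ _ hk]
        simp only [hDC]
        rw [binomialProductSum.const_mul _ _ _ _ hk]
        exact mul_mem (ofNat_mem _ 2) (ih b c (by omega) (by omega)).1
      · refine add_mem (ih (b - 1) (c - 1) (by omega) (by omega)).2 ?_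
        rcases hb'.eq_or_lt with he' | he'
        · rw [reflect D n _ _ 1]
          simp only [hD]
          exact (ih _ _ (by linarith) (by linarith)).2
        · exact (ih b c (by omega) (by omega)).2

end binomialProductSum

end BinomialProductSum

namespace Polynomial.Chebyshev

variable (R : Type*) [CommRing R]

theorem T_add_T_one_sub (l : ℤ) :
    T R l + T R (1 - l) = (1 + X) * (U R (l - 1) - U R (l - 2)) := by
  have h₁ := T_eq_U_sub_X_mul_U R l
  have h₂ := T_eq_U_sub_X_mul_U R (l - 1)
  have h₃ := U_eq R l
  rw [show l - 1 - 1 = l - 2 by ring] at h₂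
  rw [← T_neg R (1 - l), neg_sub]
  linear_combination h₁ + h₂ + h₃

theorem U_sub_add_U_neg_sub (l : ℤ) :
    U R (l - 1) - U R (l - 2) + (U R (-l - 1) - U R (-l - 2)) = 2 * T R l := by
  have h₁ := T_eq_U_sub_X_mul_U R l
  have h₃ := U_eq R l
  rw [U_neg_sub_one, U_neg_sub_two]
  linear_combination -2 * h₁ - h₃

end Polynomial.Chebyshev

theorem binomialProductSum_T_mem_adjoin {k : ℤ} (hk : 0 < k) (n : ℕ) (b c : ℤ)
    (h : |b + c - n| ≤ k) :
    binomialProductSum k (Chebyshev.T ℝ) n b c ∈ Algebra.adjoin ℕ {(1 + X : ℝ[X])} := by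
  wlog hb : 0 ≤ b + c - n generalizing b c
  · rw [binomialProductSum.reflect _ _ _ _ 0]
    simp only [zero_sub, Chebyshev.T_neg]
    refine this _ _ ?_ (by linarith)
    rw [← abs_neg]
    convert h using 2
    ring
  refine (binomialProductSum.mem_adjoin n b c hk (D := fun l => Chebyshev.U ℝ (l - 1) -
    Chebyshev.U ℝ (l - 2)) (by simp) (by simp) (Chebyshev.T_neg ℝ) (fun l => ?_)
    (Chebyshev.T_add_T_one_sub ℝ) (Chebyshev.U_sub_add_U_neg_sub ℝ) hb (abs_le.1 h).2).1
  rw [show 1 - l - 1 = -l by ring, show 1 - l - 2 = -l - 1 by ring, Chebyshev.U_neg,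
    Chebyshev.U_neg_sub_one]
  ring

theorem stmt2 (k M N : ℕ) (hk : 0 < k) (h : |(M : ℤ) - N| ≤ k) :
    ∃ (m : ℕ) (a : ℕ → ℕ), ∀ x : ℝ,
      ∑ l ∈ Finset.Icc (-((M : ℤ) + N)) ((M : ℤ) + N),
        (zchoose (M + N) ((M : ℤ) - k * l) : ℝ) ^ 2 * Real.cos (l * x)
      = ∑ p ∈ Finset.range (m + 1), (a p : ℝ) * (1 + Real.cos x) ^ p := by
  have hk' : (0 : ℤ) < k := by exact_mod_cast hk
  have hmem := binomialProductSum_T_mem_adjoin hk' (M + N) M M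
    (by convert h using 2; push_cast; ring)
  rw [Algebra.adjoin_singleton_eq_range_aeval] at hmem
  obtain ⟨p, hp⟩ := hmem
  refine ⟨p.natDegree, p.coeff, fun x => ?_⟩
  have hsum : binomialProductSum (k : ℤ) (Chebyshev.T ℝ) (M + N) M M =
      ∑ l ∈ Finset.Icc (-((M : ℤ) + N)) ((M : ℤ) + N),
        ((zchoose (M + N) (M - k * l) * zchoose (M + N) (M - k * l) : ℕ) : ℝ[X]) *
          Chebyshev.T ℝ l := by
    refine finsum_eq_sum_of_support_subset _ fun l hl => ?_
    by_contra hl'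
    refine hl ?_
    have hout : (M : ℤ) - k * l < 0 ∨ ((M + N : ℕ) : ℤ) < M - k * l := by
      simp only [Finset.coe_Icc, Set.mem_Icc, not_and_or, not_le] at hl'
      push_cast
      rcases hl' with hl' | hl'
      · right; nlinarith
      · left; nlinarith
    simp [zchoose_eq_zero hout]
  have heval := congrArg (eval (Real.cos x)) (hp.trans hsum)
  simp only [AlgHom.toRingHom_eq_coe, RingHom.coe_coe, aeval_eq_sum_range, eval_finsetSum,
    eval_mul, eval_natCast, Chebyshev.T_real_cos, nsmul_eq_mul, eval_pow, eval_add, eval_one,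
    eval_X, ← sq, Nat.cast_pow] at heval
  exact heval.symm
end

section
/- Let k be a positive integer and let M, N be nonnegative integers. For each nonnegative integer p, let c_p be the number of pairs (u, v) of binary words of length M + N, where both u and v have exactly M ones and N zeros, such that (u, v) is of class p with respect to k and moreover −2k < d_s < 2k for every s with 1 ≤ s ≤ M + N, where d_s = ∑_{j=1}^{s} (u_j − v_j). Then for every real number x, ∑_{l ∈ ℤ} C(M+N, M−kl) · C(M+N, N−kl) · cos(l·x) = ∑_{p ≥ 0} c_p · (1 + cos x)^p (the sum over p is finite since c_p = 0 for all large p). -/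
/-- The number of ones in a binary word of length `n`. -/
def ones {n : ℕ} (u : Fin n → Bool) : ℕ := (Finset.univ.filter fun j => u j = true).card

/-- The partial sum `d_s = ∑_{j=1}^{s} (u_j - v_j)` (computed in `ℤ`). -/
def dval {n : ℕ} (u v : Fin n → Bool) (s : ℕ) : ℤ :=
  ∑ j ∈ Finset.univ.filter (fun j : Fin n => (j : ℕ) < s),
    ((if u j then 1 else 0) - (if v j then 1 else 0) : ℤ)

/-- The list of cut positions starting from position `t`: the next cut is the least
`s` with `t < s ≤ n` and `|d s − d t| = k`.  The `fuel` argument (taken `≥ n`)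
guarantees termination; since each cut position strictly increases, fuel `n + 1`
produces all cut positions. -/
def cutList (k n : ℕ) (d : ℕ → ℤ) : ℕ → ℕ → List ℕ
  | 0, _ => []
  | fuel + 1, t =>
    let S := (Finset.Ioc t n).filter fun s => (d s - d t).natAbs = k
    if h : S.Nonempty then S.min' h :: cutList k n d fuel (S.min' h)
    else []

/-- The class of a pair of words with partial-sum sequence `d` (with respect to `k`):
the number of cut positions `t` with `d t = k` or `d t = −k`. -/
def classOf (k n : ℕ) (d : ℕ → ℤ) : ℕ :=
  ((cutList k n d (n + 1) 0).filter fun t => decide (d t = (k : ℤ) ∨ d t = -(k : ℤ))).length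

/-- The number of cuts at height `±k` along the path `d 1, …, d n`, when the last cut before it
was made at height `c`. -/
def cutCount (k : ℕ) : ℕ → (ℕ → ℤ) → ℤ → ℕ
  | 0, _, _ => 0
  | n + 1, d, c =>
    if (d 1 - c).natAbs = k then
      (if d 1 = (k : ℤ) ∨ d 1 = -(k : ℤ) then 1 else 0) + cutCount k n (fun s => d (s + 1)) (d 1)
    else cutCount k n (fun s => d (s + 1)) c

lemma cutCount_le (k n : ℕ) (d : ℕ → ℤ) (c : ℤ) : cutCount k n d c ≤ n := by
  induction n generalizing d c with
  | zero => simp [cutCount]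
  | succ n ih =>
    have h1 := ih (fun s => d (s + 1)) (d 1)
    have h2 := ih (fun s => d (s + 1)) c
    simp only [cutCount]
    split_ifs <;> omega

lemma length_filter_cutList (k n m : ℕ) (d : ℕ → ℤ) (fuel t s : ℕ) (hts : t ≤ s)
    (hs : s + m = n) (hfuel : m ≤ fuel)
    (hno : ∀ j, t < j → j ≤ s → (d j - d t).natAbs ≠ k) :
    ((cutList k n d fuel t).filter
        fun t => decide (d t = (k : ℤ) ∨ d t = -(k : ℤ))).length
      = cutCount k m (fun j => d (s + j)) (d t) := by
  induction m generalizing fuel t s with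
  | zero =>
    obtain rfl : s = n := by omega
    cases fuel with
    | zero => simp [cutList, cutCount]
    | succ fuel =>
      have hS : ¬ ((Finset.Ioc t s).filter fun j => (d j - d t).natAbs = k).Nonempty := by
        rintro ⟨j, hj⟩
        simp only [Finset.mem_filter, Finset.mem_Ioc] at hj
        exact hno j hj.1.1 hj.1.2 hj.2
      simp [cutList, cutCount, hS]
  | succ m ih =>
    obtain ⟨fuel, rfl⟩ : ∃ f, fuel = f + 1 := ⟨fuel - 1, by omega⟩
    have hshift : (fun j => d (s + (j + 1))) = fun j => d (s + 1 + j) := by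
      funext j; congr 1; omega
    by_cases hcut : (d (s + 1) - d t).natAbs = k
    · have hmem : s + 1 ∈ (Finset.Ioc t n).filter fun j => (d j - d t).natAbs = k := by
        simp only [Finset.mem_filter, Finset.mem_Ioc]
        exact ⟨⟨by omega, by omega⟩, hcut⟩
      have hmin : ((Finset.Ioc t n).filter fun j => (d j - d t).natAbs = k).min' ⟨_, hmem⟩
          = s + 1 := by
        refine le_antisymm (Finset.min'_le _ _ hmem) (Finset.le_min' _ _ _ fun j hj => ?_)
        simp only [Finset.mem_filter, Finset.mem_Ioc] at hj
        by_contra hlt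
        exact hno j hj.1.1 (by omega) hj.2
      have hrec := ih fuel (s + 1) (s + 1) le_rfl (by omega) (by omega)
        (fun j h1 h2 => absurd h1 (by omega))
      have hne : ((Finset.Ioc t n).filter fun j => (d j - d t).natAbs = k).Nonempty := ⟨_, hmem⟩
      simp only [cutList, cutCount, hne, dif_pos, hmin, hcut, if_true, hshift, ← hrec,
        List.filter_cons]
      split_ifs <;> simp_all [add_comm]
    · have hrec := ih (fuel + 1) t (s + 1) (by omega) (by omega) (by omega) (fun j h1 h2 => by
        rcases Nat.lt_or_ge s j with h | h
        · obtain rfl : j = s + 1 := by omega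
          exact hcut
        · exact hno j h1 h)
      rw [hrec]
      simp only [cutCount, hcut, if_false, hshift]

lemma classOf_eq_cutCount (k n : ℕ) (d : ℕ → ℤ) (h0 : d 0 = 0) :
    classOf k n d = cutCount k n d 0 := by
  have h := length_filter_cutList k n n d (n + 1) 0 0 le_rfl (by omega) (by omega)
    (fun j h1 h2 => absurd h1 (by omega))
  rw [h0] at h
  simpa [classOf] using h

/-- The numerical value of a letter. -/
def letter (a : Bool) : ℤ := if a then 1 else 0

lemma dval_zero {n : ℕ} (u v : Fin n → Bool) : dval u v 0 = 0 := by simp [dval]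

lemma dval_cons_succ {n : ℕ} (a b : Bool) (u v : Fin n → Bool) (s : ℕ) :
    dval (Fin.cons a u : Fin (n + 1) → Bool) (Fin.cons b v : Fin (n + 1) → Bool) (s + 1)
      = letter a - letter b + dval u v s := by
  simp only [dval, Finset.sum_filter, Fin.sum_univ_succ]
  simp [letter]

lemma ones_cons {n : ℕ} (a : Bool) (u : Fin n → Bool) :
    (ones (Fin.cons a u : Fin (n + 1) → Bool) : ℤ) = letter a + ones u := by
  simp only [ones, Finset.card_filter, Fin.sum_univ_succ]
  simp [letter]

lemma dval_length {n : ℕ} (u v : Fin n → Bool) : dval u v n = (ones u : ℤ) - ones v := by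
  simp [dval, ones]

lemma ones_le {n : ℕ} (u : Fin n → Bool) : ones u ≤ n := by
  simpa [ones] using Finset.card_filter_le (Finset.univ : Finset (Fin n)) (fun j => u j = true)

lemma sum_word_succ {n : ℕ} (f : (Fin (n + 1) → Bool) → ℝ) :
    ∑ u, f u = ∑ a : Bool, ∑ u : Fin n → Bool, f (Fin.cons a u) := by
  rw [← Fintype.sum_prod_type', ← (Fin.consEquiv fun _ => Bool).sum_comp]
  rfl

lemma card_ones_eq_zchoose (n : ℕ) (c : ℤ) :
    (Finset.univ.filter fun u : Fin n → Bool => (ones u : ℤ) = c).card = zchoose n c := by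
  unfold zchoose
  split_ifs with hc
  · lift c to ℕ using hc
    have h := Finset.card_powersetCard c (Finset.univ : Finset (Fin n))
    rw [Finset.card_univ, Fintype.card_fin] at h
    rw [Int.toNat_natCast, ← h]
    refine Finset.card_bij' (fun u _ => Finset.univ.filter fun j => u j = true)
      (fun S _ j => decide (j ∈ S)) ?_ ?_ ?_ ?_
    · intro u hu
      simpa [Finset.mem_powersetCard, ones] using hu
    · intro S hS
      simpa [Finset.mem_powersetCard, ones] using hS
    · intro u _
      funext j
      simp
    · intro S _
      ext j
      simp
  · rw [Finset.card_eq_zero, Finset.filter_eq_empty_iff]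
    intro u _
    omega

lemma zchoose_symm_s7 (M N : ℕ) (j : ℤ) :
    zchoose (M + N) ((N : ℤ) - j) = zchoose (M + N) ((M : ℤ) + j) := by
  unfold zchoose
  split_ifs with h1 h2 h2
  · rw [← Nat.choose_symm_of_eq_add (n := M + N) (a := ((M : ℤ) + j).toNat)
      (b := ((N : ℤ) - j).toNat)]
    omega
  · exact Nat.choose_eq_zero_of_lt (by omega)
  · exact (Nat.choose_eq_zero_of_lt (by omega)).symm
  · rfl

/-- The sum of `cos ((e + d_n) x / (2k))` over pairs of words of length `n` with `t` ones in total
such that `e + d_n ≡ ρ` modulo `2k`. -/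
noncomputable def cosSum (k : ℕ) (x : ℝ) (ρ : ℤ) (n : ℕ) (t e : ℤ) : ℝ :=
  ∑ u : Fin n → Bool, ∑ v : Fin n → Bool,
    if (ones u : ℤ) + ones v = t ∧ (2 * k : ℤ) ∣ e + dval u v n - ρ then
      Real.cos ((e + dval u v n : ℤ) * x / (2 * k)) else 0

lemma cosSum_succ (k : ℕ) (x : ℝ) (ρ : ℤ) (n : ℕ) (t e : ℤ) :
    cosSum k x ρ (n + 1) t e = ∑ a : Bool, ∑ b : Bool,
      cosSum k x ρ n (t - (letter a + letter b)) (e + (letter a - letter b)) := by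
  simp only [cosSum, sum_word_succ]
  refine Finset.sum_congr rfl fun a _ => ?_
  rw [Finset.sum_comm]
  refine Finset.sum_congr rfl fun b _ => ?_
  refine Finset.sum_congr rfl fun u _ => Finset.sum_congr rfl fun v _ => ?_
  simp only [ones_cons, dval_cons_succ, add_assoc]
  congr 2
  simp only [eq_iff_iff]
  constructor <;> intro h <;> linarith

lemma cosSum_neg (k : ℕ) (x : ℝ) {ρ : ℤ} (hρ : (2 * k : ℤ) ∣ 2 * ρ) (n : ℕ) (t e : ℤ) :
    cosSum k x ρ n t (-e) = cosSum k x ρ n t e := by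
  simp only [cosSum]
  rw [Finset.sum_comm]
  refine Finset.sum_congr rfl fun u _ => Finset.sum_congr rfl fun v _ => ?_
  have h : -e + dval v u n = -(e + dval u v n) := by
    rw [dval_length, dval_length]; ring
  have h2 : (2 * k : ℤ) ∣ -(e + dval u v n) - ρ ↔ (2 * k : ℤ) ∣ e + dval u v n - ρ := by
    rw [← dvd_neg, ← Int.dvd_add_right (dvd_neg.mpr hρ)]
    ring_nf
  simp only [h, h2, add_comm (ones v : ℤ)]
  congr 1
  rw [← Real.cos_neg]
  push_cast
  ring_nf

lemma cosSum_add_cosSum {k : ℕ} (hk : 0 < k) (x : ℝ) (ρ σ : ℤ) (h : (2 * k : ℤ) ∣ ρ - σ - k)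
    (n : ℕ) (t : ℤ) :
    cosSum k x ρ n t k + cosSum k x ρ n t (-k) = 2 * Real.cos (x / 2) * cosSum k x σ n t 0 := by
  simp only [cosSum, ← Finset.sum_add_distrib, Finset.mul_sum]
  refine Finset.sum_congr rfl fun u _ => Finset.sum_congr rfl fun v _ => ?_
  have h1 : (2 * k : ℤ) ∣ k + dval u v n - ρ ↔ (2 * k : ℤ) ∣ 0 + dval u v n - σ := by
    rw [← Int.dvd_add_right h]
    ring_nf
  have h2 : (2 * k : ℤ) ∣ -k + dval u v n - ρ ↔ (2 * k : ℤ) ∣ 0 + dval u v n - σ := by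
    rw [← Int.dvd_add_right (dvd_add h (dvd_refl (2 * k : ℤ)))]
    ring_nf
  simp only [h1, h2]
  split_ifs
  · have hk' : (k : ℝ) ≠ 0 := by positivity
    have e1 : (((k : ℤ) + dval u v n : ℤ) : ℝ) * x / (2 * k)
        = ((0 + dval u v n : ℤ) : ℝ) * x / (2 * k) + x / 2 := by
      push_cast; field_simp; ring
    have e2 : ((-(k : ℤ) + dval u v n : ℤ) : ℝ) * x / (2 * k)
        = ((0 + dval u v n : ℤ) : ℝ) * x / (2 * k) - x / 2 := by
      push_cast; field_simp; ring
    rw [e1, e2, Real.cos_add, Real.cos_sub]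
    ring
  · simp

/-- The sum of `y ^ p`, where `p` counts the cuts at height `±k`, over pairs of words of length `n`
with `t` ones in total whose path, started at height `e` after a cut at height `c`, ends at `0`
and stays strictly between `-2k` and `2k`. -/
noncomputable def pathSum (k : ℕ) (y : ℝ) (n : ℕ) (t e c : ℤ) : ℝ :=
  ∑ u : Fin n → Bool, ∑ v : Fin n → Bool,
    if (ones u : ℤ) + ones v = t ∧ e + dval u v n = 0 ∧
        ∀ s < n, -(2 * k : ℤ) < e + dval u v (s + 1) ∧ e + dval u v (s + 1) < 2 * k then
      y ^ cutCount k n (fun s => e + dval u v s) c else 0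

/-- The contribution to `pathSum` of the paths whose first step leads to height `e`. -/
noncomputable def pathStep (k : ℕ) (y : ℝ) (n : ℕ) (t e c : ℤ) : ℝ :=
  if -(2 * k : ℤ) < e ∧ e < 2 * k then
    if (e - c).natAbs = k then
      y ^ (if e = (k : ℤ) ∨ e = -(k : ℤ) then 1 else 0) * pathSum k y n t e e
    else pathSum k y n t e c
  else 0

lemma pathSum_succ (k : ℕ) (y : ℝ) (n : ℕ) (t e c : ℤ) :
    pathSum k y (n + 1) t e c = ∑ a : Bool, ∑ b : Bool,
      pathStep k y n (t - (letter a + letter b)) (e + (letter a - letter b)) c := by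
  simp only [pathSum, sum_word_succ]
  refine Finset.sum_congr rfl fun a _ => ?_
  rw [Finset.sum_comm]
  refine Finset.sum_congr rfl fun b _ => ?_
  have hones : ∀ u v : Fin n → Bool,
      (letter a + (ones u : ℤ) + (letter b + ones v) = t) =
        ((ones u : ℤ) + ones v = t - (letter a + letter b)) := by
    intro u v
    simp only [eq_iff_iff]
    constructor <;> intro h <;> linarith
  have hall : ∀ (P : ℕ → Prop), (∀ s < n + 1, P s) ↔ P 0 ∧ ∀ s < n, P (s + 1) := by
    intro P
    refine ⟨fun h => ⟨h 0 (by omega), fun s hs => h _ (by omega)⟩, fun h s hs => ?_⟩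
    cases s with
    | zero => exact h.1
    | succ s => exact h.2 s (by omega)
  simp only [ones_cons, dval_cons_succ, hall, hones, cutCount, dval_zero, add_zero,
    ← add_assoc e, pathStep, pathSum]
  generalize t - (letter a + letter b) = t'
  generalize e + (letter a - letter b) = e'
  by_cases h1 : -(2 * k : ℤ) < e' ∧ e' < 2 * k
  · by_cases h2 : (e' - c).natAbs = k
    · simp only [h1, h2, true_and, and_self, if_true, Finset.mul_sum]
      refine Finset.sum_congr rfl fun u _ => Finset.sum_congr rfl fun v _ => ?_
      rw [mul_ite, mul_zero, pow_add]
    · simp only [h1, h2, true_and, and_self, if_true, if_false]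
  · simp [h1]

lemma pathSum_neg (k : ℕ) (y : ℝ) (n : ℕ) (t e c : ℤ) :
    pathSum k y n t (-e) (-c) = pathSum k y n t e c := by
  have hcut : ∀ (n : ℕ) (d : ℕ → ℤ) (c : ℤ),
      cutCount k n (fun s => -d s) (-c) = cutCount k n d c := by
    intro n
    induction n with
    | zero => intro d c; rfl
    | succ n ih =>
      intro d c
      simp only [cutCount]
      have h1 : (-d 1 - -c).natAbs = (d 1 - c).natAbs := by omega
      have h2 : (-d 1 = (k : ℤ) ∨ -d 1 = -(k : ℤ)) ↔ (d 1 = (k : ℤ) ∨ d 1 = -(k : ℤ)) := by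
        omega
      simp only [h1, h2, ih (fun s => d (s + 1))]
  have hswap : ∀ (u v : Fin n → Bool) (s : ℕ), dval v u s = -dval u v s := by
    intro u v s
    rw [dval, dval, ← Finset.sum_neg_distrib]
    exact Finset.sum_congr rfl fun j _ => by ring
  simp only [pathSum]
  rw [Finset.sum_comm]
  refine Finset.sum_congr rfl fun u _ => Finset.sum_congr rfl fun v _ => ?_
  have hd : ∀ s, -e + dval v u s = -(e + dval u v s) := by
    intro s; rw [hswap]; ring
  simp only [hd, hcut, add_comm (ones v : ℤ)]
  congr 2
  simp only [neg_eq_zero, eq_iff_iff]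
  refine and_congr_right fun _ => forall₂_congr fun s _ => ?_
  constructor <;> rintro ⟨h1, h2⟩ <;> constructor <;> linarith

lemma pathStep_zero_eq_cosSum {k : ℕ} (hk : 0 < k) (x : ℝ) (n : ℕ) (t : ℤ)
    (h0 : ∀ e : ℤ, |e| < k → pathSum k (1 + Real.cos x) n t e 0 = cosSum k x 0 n t e)
    (h1 : ∀ r : ℤ, |r| < k → Real.cos (x / 2) *
      (pathSum k (1 + Real.cos x) n t (k + r) k + pathSum k (1 + Real.cos x) n t (k - r) k)
        = cosSum k x k n t r) (e : ℤ) (he : |e| ≤ k) :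
    pathStep k (1 + Real.cos x) n t e 0 = cosSum k x 0 n t e := by
  rcases he.lt_or_eq with hlt | heq
  · rw [← h0 e hlt, pathStep, if_pos (by rw [abs_lt] at hlt; omega),
      if_neg (by rw [abs_lt] at hlt; omega)]
  · have hk1 : pathStep k (1 + Real.cos x) n t e 0
        = (1 + Real.cos x) * pathSum k (1 + Real.cos x) n t k k := by
      rcases abs_eq (by omega) |>.mp heq with rfl | rfl
      · simp [pathStep, show -(2 * k : ℤ) < k by omega, show (k : ℤ) < 2 * k by omega]
      · have hneg := pathSum_neg k (1 + Real.cos x) n t k k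
        simp [pathStep, show -(k : ℤ) < 2 * k by omega, hneg, hk]
    have hE : cosSum k x 0 n t e = cosSum k x 0 n t k := by
      rcases abs_eq (by omega) |>.mp heq with rfl | rfl
      · rfl
      · exact cosSum_neg k x (by simp) n t k
    have hadd := cosSum_add_cosSum hk x 0 k ⟨-1, by ring⟩ n t
    rw [cosSum_neg k x (by simp)] at hadd
    have hr := h1 0 (by simpa using hk)
    have hcos : 1 + Real.cos x = 2 * Real.cos (x / 2) ^ 2 := by
      rw [Real.cos_sq, mul_div_cancel₀ x two_ne_zero]; ring
    rw [hk1, hE, hcos]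
    simp only [add_zero, sub_zero, hcos] at hr
    rw [← hr] at hadd
    linarith

lemma pathStep_add_eq_cosSum {k : ℕ} (hk : 0 < k) (x : ℝ) (n : ℕ) (t : ℤ)
    (h0 : ∀ e : ℤ, |e| < k → pathSum k (1 + Real.cos x) n t e 0 = cosSum k x 0 n t e)
    (h1 : ∀ r : ℤ, |r| < k → Real.cos (x / 2) *
      (pathSum k (1 + Real.cos x) n t (k + r) k + pathSum k (1 + Real.cos x) n t (k - r) k)
        = cosSum k x k n t r) (r : ℤ) (hr : |r| ≤ k) :
    Real.cos (x / 2) * (pathStep k (1 + Real.cos x) n t (k + r) k +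
      pathStep k (1 + Real.cos x) n t (k - r) k) = cosSum k x k n t r := by
  rcases hr.lt_or_eq with hlt | heq
  · rw [← h1 r hlt]
    rw [abs_lt] at hlt
    rw [pathStep, pathStep, if_pos (by omega), if_neg (by omega), if_pos (by omega),
      if_neg (by omega)]
  · have htop : pathStep k (1 + Real.cos x) n t (k + k) k = 0 := by
      rw [pathStep, if_neg (by omega)]
    have hbot : pathStep k (1 + Real.cos x) n t 0 k = cosSum k x 0 n t 0 := by
      rw [pathStep, if_pos (by omega), if_pos (by omega), if_neg (by omega), pow_zero, one_mul,
        h0 0 (by simpa using hk)]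
    have hadd := cosSum_add_cosSum hk x k 0 (by simp) n t
    have hneg := cosSum_neg k x (dvd_refl (2 * k : ℤ)) n t k
    rcases abs_eq (by omega) |>.mp heq with rfl | rfl
    · rw [htop, sub_self, hbot]
      linarith
    · rw [sub_neg_eq_add, htop, add_neg_cancel, hbot]
      linarith

lemma pathSum_eq_cosSum {k : ℕ} (hk : 0 < k) (x : ℝ) (n : ℕ) (t : ℤ) :
    (∀ e : ℤ, |e| < k → pathSum k (1 + Real.cos x) n t e 0 = cosSum k x 0 n t e) ∧
    (∀ r : ℤ, |r| < k → Real.cos (x / 2) *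
      (pathSum k (1 + Real.cos x) n t (k + r) k + pathSum k (1 + Real.cos x) n t (k - r) k)
        = cosSum k x k n t r) := by
  induction n generalizing t with
  | zero =>
    constructor
    · intro e he
      have hdvd : (2 * k : ℤ) ∣ e ↔ e = 0 := by
        refine ⟨fun h => Int.eq_zero_of_abs_lt_dvd h (by omega), fun h => h ▸ dvd_zero _⟩
      simp only [pathSum, cosSum, dval_zero, add_zero, sub_zero, hdvd, cutCount]
      by_cases he0 : e = 0 <;> simp [he0]
    · intro r hr
      have hdvd : ¬ (2 * k : ℤ) ∣ r - k := by
        rintro ⟨q, hq⟩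
        rw [abs_lt] at hr
        rcases lt_trichotomy q 0 with h | h | h
        · nlinarith
        · subst h; omega
        · nlinarith
      rw [abs_lt] at hr
      simp [pathSum, cosSum, dval_zero, hdvd, show (k : ℤ) + r ≠ 0 by omega,
        show (k : ℤ) - r ≠ 0 by omega]
  | succ n ih =>
    have hletter : ∀ a b : Bool, |letter a - letter b| ≤ 1 := by decide
    constructor
    · intro e he
      rw [pathSum_succ, cosSum_succ]
      refine Finset.sum_congr rfl fun a _ => Finset.sum_congr rfl fun b _ => ?_
      refine pathStep_zero_eq_cosSum hk x n _ (ih _).1 (ih _).2 _ ?_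
      have := abs_add_le e (letter a - letter b)
      have := hletter a b
      omega
    · intro r hr
      have hflip : pathSum k (1 + Real.cos x) (n + 1) t (k - r) k = ∑ a : Bool, ∑ b : Bool,
          pathStep k (1 + Real.cos x) n (t - (letter a + letter b))
            (k - (r + (letter a - letter b))) k := by
        rw [pathSum_succ, Finset.sum_comm]
        refine Finset.sum_congr rfl fun a _ => Finset.sum_congr rfl fun b _ => ?_
        congr 1 <;> ring
      rw [hflip, pathSum_succ, cosSum_succ, ← Finset.sum_add_distrib, Finset.mul_sum]
      refine Finset.sum_congr rfl fun a _ => ?_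
      rw [← Finset.sum_add_distrib, Finset.mul_sum]
      refine Finset.sum_congr rfl fun b _ => ?_
      rw [add_assoc (k : ℤ)]
      refine pathStep_add_eq_cosSum hk x n _ (ih _).1 (ih _).2 _ ?_
      have := abs_add_le r (letter a - letter b)
      have := hletter a b
      omega

lemma sum_zchoose_eq_cosSum {k : ℕ} (hk : 0 < k) (M N : ℕ) (x : ℝ) :
    ∑ l ∈ Finset.Icc (-((M : ℤ) + N)) ((M : ℤ) + N),
        (zchoose (M + N) ((M : ℤ) - k * l) : ℝ) *
          (zchoose (M + N) ((N : ℤ) - k * l) : ℝ) * Real.cos (l * x)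
      = cosSum k x 0 (M + N) (2 * M) 0 := by
  have hterm : ∀ l : ℤ, (zchoose (M + N) ((M : ℤ) - k * l) : ℝ) *
        (zchoose (M + N) ((N : ℤ) - k * l) : ℝ) * Real.cos (l * x)
      = ∑ u : Fin (M + N) → Bool, ∑ v : Fin (M + N) → Bool,
        if (ones u : ℤ) = M + k * l ∧ (ones v : ℤ) = M - k * l then Real.cos (l * x) else 0 := by
    intro l
    rw [zchoose_symm_s7, ← card_ones_eq_zchoose, ← card_ones_eq_zchoose, mul_comm (Nat.cast _),
      Finset.card_filter, Finset.card_filter]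
    push_cast
    rw [Finset.sum_mul_sum, Finset.sum_mul]
    refine Finset.sum_congr rfl fun u _ => ?_
    rw [Finset.sum_mul]
    refine Finset.sum_congr rfl fun v _ => ?_
    split_ifs <;> simp_all
  simp only [hterm, cosSum]
  rw [Finset.sum_comm]
  refine Finset.sum_congr rfl fun u _ => ?_
  rw [Finset.sum_comm]
  refine Finset.sum_congr rfl fun v _ => ?_
  rw [dval_length, zero_add, sub_zero]
  have hk' : (0 : ℤ) < k := by exact_mod_cast hk
  split_ifs with h
  · obtain ⟨h1, q, hq⟩ := h
    have hu : (ones u : ℤ) = M + k * q := by linarith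
    have hv : (ones v : ℤ) = M - k * q := by linarith
    have hul : (ones u : ℤ) ≤ M + N := by exact_mod_cast ones_le u
    have hvl : (ones v : ℤ) ≤ M + N := by exact_mod_cast ones_le v
    rw [Finset.sum_eq_single q]
    · rw [if_pos ⟨hu, hv⟩, hq]
      have : (k : ℝ) ≠ 0 := by positivity
      congr 1
      push_cast
      field_simp
    · intro l _ hlq
      refine if_neg fun hl => hlq ?_
      exact mul_left_cancel₀ hk'.ne' (by linarith [hl.1])
    · intro hmem
      refine absurd (Finset.mem_Icc.mpr ⟨?_, ?_⟩) hmem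
      · by_contra hlt
        push Not at hlt
        nlinarith
      · by_contra hlt
        push Not at hlt
        nlinarith
  · refine Finset.sum_eq_zero fun l _ => if_neg fun hl => h ⟨by linarith [hl.1, hl.2], l, ?_⟩
    linarith [hl.1, hl.2]

open scoped Classical in
theorem stmt7 (k M N : ℕ) (hk : 0 < k)
    (b : ℕ → ℕ)
    (hb : ∀ p : ℕ, b p =
      (Finset.univ.filter fun uv : (Fin (M + N) → Bool) × (Fin (M + N) → Bool) =>
        ones uv.1 = M ∧ ones uv.2 = M ∧
        classOf k (M + N) (dval uv.1 uv.2) = p ∧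
        ∀ s ∈ Finset.Icc 1 (M + N),
          -(2 * k : ℤ) < dval uv.1 uv.2 s ∧ dval uv.1 uv.2 s < 2 * k).card) :
    ∀ x : ℝ,
      ∑ l ∈ Finset.Icc (-((M : ℤ) + N)) ((M : ℤ) + N),
        (zchoose (M + N) ((M : ℤ) - k * l) : ℝ) *
          (zchoose (M + N) ((N : ℤ) - k * l) : ℝ) * Real.cos (l * x)
      = ∑ p ∈ Finset.range (M + N + 1), (b p : ℝ) * (1 + Real.cos x) ^ p := by
  intro x
  rw [sum_zchoose_eq_cosSum hk, ← (pathSum_eq_cosSum hk x (M + N) (2 * M)).1 0 (by simpa using hk)]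
  have hcond : ∀ u v : Fin (M + N) → Bool,
      ((ones u : ℤ) + ones v = 2 * M ∧ 0 + dval u v (M + N) = 0 ∧
        ∀ s < M + N, -(2 * k : ℤ) < 0 + dval u v (s + 1) ∧ 0 + dval u v (s + 1) < 2 * k) ↔
      (ones u = M ∧ ones v = M ∧ ∀ s ∈ Finset.Icc 1 (M + N),
          -(2 * k : ℤ) < dval u v s ∧ dval u v s < 2 * k) := by
    intro u v
    rw [dval_length]
    constructor
    · rintro ⟨h1, h2, h3⟩
      refine ⟨by omega, by omega, fun s hs => ?_⟩
      rw [Finset.mem_Icc] at hs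
      have := h3 (s - 1) (by omega)
      rwa [Nat.sub_add_cancel hs.1, zero_add] at this
    · rintro ⟨h1, h2, h3⟩
      refine ⟨by omega, by omega, fun s hs => ?_⟩
      rw [zero_add]
      exact h3 (s + 1) (Finset.mem_Icc.mpr ⟨by omega, by omega⟩)
  simp only [pathSum, hcond, hb, Finset.card_filter, Nat.cast_sum, Finset.sum_mul]
  conv_rhs => rw [Finset.sum_comm, Fintype.sum_prod_type]
  refine Finset.sum_congr rfl fun u _ => Finset.sum_congr rfl fun v _ => ?_
  have hclass : cutCount k (M + N) (fun s => 0 + dval u v s) 0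
      = classOf k (M + N) (dval u v) := by
    rw [classOf_eq_cutCount _ _ _ (dval_zero u v)]
    simp only [zero_add]
  have hle : classOf k (M + N) (dval u v) ≤ M + N := by
    rw [← hclass]
    exact cutCount_le _ _ _ _
  rw [hclass, Finset.sum_eq_single (classOf k (M + N) (dval u v))]
  · split_ifs <;> simp_all
  · intro p _ hp
    simp [hp.symm]
  · intro hmem
    exact absurd (Finset.mem_range.mpr (by omega)) hmem
end
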